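/- There do not exist an integer p ≥ 3 and points a, b₀, b₁, …, b_{p−1} of the Euclidean plane ℝ² (indices taken modulo p) such that for every i the triple (a, b_i, b_{i+1}) is affinely independent and for every i the two angles at b_i in the adjacent triangles satisfy ∠ a b_i b_{i−1} + ∠ a b_i b_{i+1} > π. -/

import Mathlib

open EuclideanGeometry Real

theorem no_closed_ring_of_bb_triangles :
    ¬ ∃ (p : ℕ) (a : EuclideanSpace ℝ (Fin 2)) (b : ZMod p → EuclideanSpace ℝ (Fin 2)),
      3 ≤ p ∧
      (∀ i : ZMod p, AffineIndependent ℝ ![a, b i, b (i + 1)]) ∧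
      (∀ i : ZMod p, ∠ a (b i) (b (i - 1)) + ∠ a (b i) (b (i + 1)) > π) := by
  rintro ⟨p, a, b, hp, hind, hbb⟩
  have : NeZero p := ⟨by omega⟩
  have hshift : ∑ i, ∠ a (b (i + 1)) (b i) = ∑ i, ∠ a (b i) (b (i - 1)) := by
    rw [← Equiv.sum_comp (Equiv.addRight (1 : ZMod p)) fun i ↦ ∠ a (b i) (b (i - 1))]
    simp
  have hle (i : ZMod p) : ∠ a (b (i + 1)) (b i) + ∠ a (b i) (b (i + 1)) ≤ π := by
    have hne : b i ≠ a := (hind i).injective.ne (show (1 : Fin 3) ≠ 0 by decide)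
    have hsum := angle_add_angle_add_angle_eq_pi (b (i + 1)) hne
    have hnonneg := angle_nonneg (b (i + 1)) a (b i)
    rw [angle_comm a (b (i + 1))]
    linarith
  have hlt := Finset.sum_lt_sum_of_nonempty Finset.univ_nonempty fun i _ ↦ (hle i).trans_lt (hbb i)
  rw [Finset.sum_add_distrib, Finset.sum_add_distrib, hshift] at hlt
  exact lt_irrefl _ hlt
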